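/- Let $k$ be a field, and let $B_0 \to B_1$, $B_0 \to B_2$ be injective maps of augmented $k$-algebras admitting right $B_0$-module splittings $B_i = B_0 \oplus B_i'$. Let $P = B_1 \amalg_{B_0} B_2$ be the pushout of $k$-algebras. Then the natural map $P \otimes_{B_0} k \to (P \otimes_{B_1} k) \oplus (P \otimes_{B_2} k)$ induced by the two quotient maps is injective in all degrees, is surjective in positive degrees, and has cokernel isomorphic to $k$ concentrated in degree $0$. -/

import Mathlib

/-- The representation of `A` on `N × k` attached to a derivation `d : A → N`, where `A` acts on `N`
on the left through `ρ : A → P` and on the right through the augmentation `ε`. -/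
def derivationRep {k A P N : Type*} [Field k] [Ring A] [Ring P] [Algebra k A] [Algebra k P]
    [AddCommGroup N] [Module k N] [Module P N] [IsScalarTower k P N]
    (ρ : A →ₐ[k] P) (ε : A →ₐ[k] k) (d : A →ₗ[k] N)
    (hd : ∀ a b, d (a * b) = ρ a • d b + ε b • d a) : A →ₐ[k] Module.End k (N × k) :=
  have hd_one : d 1 = 0 := by simpa using hd 1 1
  AlgHom.ofLinearMap
    { toFun := fun a =>
        { toFun := fun x => (ρ a • x.1 + x.2 • d a, ε a * x.2)
          map_add' := fun x y => by
            ext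
            · simp only [Prod.fst_add, Prod.snd_add, smul_add, add_smul]; abel
            · simp [mul_add]
          map_smul' := fun c x => by
            ext
            · simp only [Prod.smul_fst, Prod.smul_snd, smul_eq_mul, mul_smul, smul_add,
                smul_comm (ρ a) c, RingHom.id_apply]
            · simp [mul_left_comm] }
      map_add' := fun a b => by
        refine LinearMap.ext fun x => Prod.ext ?_ ?_
        · simp only [LinearMap.coe_mk, AddHom.coe_mk, LinearMap.add_apply, Prod.fst_add, map_add,
            smul_add, add_smul]
          abel
        · simp [add_mul]
      map_smul' := fun c a => by
        refine LinearMap.ext fun x => Prod.ext ?_ ?_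
        · simp [smul_comm c x.2]
        · simp [mul_assoc] }
    (LinearMap.ext fun x => Prod.ext (by simp [hd_one]) (by simp))
    fun a b => by
      refine LinearMap.ext fun x => Prod.ext ?_ ?_
      · simp only [LinearMap.coe_mk, AddHom.coe_mk, Module.End.mul_apply, hd, map_mul, smul_add,
          mul_smul, smul_comm (ρ a) x.2, smul_comm x.2 (ε b)]
        abel
      · simp [mul_assoc]

/-- The relations defining `P ⊗_A k` as a quotient of `P` span a left ideal. -/
theorem mul_mem_span_augmentation {k A P : Type*} [Field k] [Ring A] [Ring P] [Algebra k A]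
    [Algebra k P] (ρ : A → P) (ε : A → k) (c : P) {x : P}
    (hx : x ∈ Submodule.span k {x | ∃ (p : P) (b : A), x = p * ρ b - ε b • p}) :
    c * x ∈ Submodule.span k {x | ∃ (p : P) (b : A), x = p * ρ b - ε b • p} := by
  induction hx using Submodule.span_induction with
  | mem x hx =>
    obtain ⟨p, b, rfl⟩ := hx
    exact Submodule.subset_span ⟨c * p, b, by simp [mul_sub, mul_assoc]⟩
  | zero => simp
  | add x y _ _ hx hy => rw [mul_add]; exact add_mem hx hy
  | smul a x _ hx => rw [mul_smul_comm]; exact Submodule.smul_mem _ _ hx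

/-- A pushout of algebras is generated by the images of its two factors. -/
theorem adjoin_range_union_range_eq_top_of_pushout {k B₀ B₁ B₂ P : Type} [Field k]
    [Ring B₀] [Ring B₁] [Ring B₂] [Ring P]
    [Algebra k B₀] [Algebra k B₁] [Algebra k B₂] [Algebra k P]
    {f₁ : B₀ →ₐ[k] B₁} {f₂ : B₀ →ₐ[k] B₂} {g₁ : B₁ →ₐ[k] P} {g₂ : B₂ →ₐ[k] P}
    (hcomm : g₁.comp f₁ = g₂.comp f₂)
    (hUP : ∀ (D : Type) [Ring D] [Algebra k D], ∀ (h₁ : B₁ →ₐ[k] D) (h₂ : B₂ →ₐ[k] D),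
      h₁.comp f₁ = h₂.comp f₂ → ∃! φ : P →ₐ[k] D, φ.comp g₁ = h₁ ∧ φ.comp g₂ = h₂) :
    Algebra.adjoin k (Set.range g₁ ∪ Set.range g₂) = ⊤ := by
  set S := Algebra.adjoin k (Set.range g₁ ∪ Set.range g₂)
  have m₁ : ∀ b, g₁ b ∈ S := fun b => Algebra.subset_adjoin (Or.inl ⟨b, rfl⟩)
  have m₂ : ∀ b, g₂ b ∈ S := fun b => Algebra.subset_adjoin (Or.inr ⟨b, rfl⟩)
  obtain ⟨φ, ⟨hφ₁, hφ₂⟩, -⟩ := hUP S (g₁.codRestrict S m₁) (g₂.codRestrict S m₂)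
    (AlgHom.ext fun b => Subtype.ext (DFunLike.congr_fun hcomm b))
  have hid : S.val.comp φ = AlgHom.id k P := by
    refine (hUP P g₁ g₂ hcomm).unique ⟨?_, ?_⟩ ⟨rfl, rfl⟩
    · rw [AlgHom.comp_assoc, hφ₁]; rfl
    · rw [AlgHom.comp_assoc, hφ₂]; rfl
  refine eq_top_iff.2 fun p _ => ?_
  have hp : (φ p : P) = p := DFunLike.congr_fun hid p
  exact hp ▸ (φ p).2

/-- Derivations on the two factors of a pushout of augmented algebras that agree on the common
algebra extend to the pushout. -/
theorem exists_derivation_of_pushout {k B₀ B₁ B₂ P N : Type} [Field k]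
    [Ring B₀] [Ring B₁] [Ring B₂] [Ring P]
    [Algebra k B₀] [Algebra k B₁] [Algebra k B₂] [Algebra k P]
    [AddCommGroup N] [Module k N] [Module P N] [IsScalarTower k P N]
    {f₁ : B₀ →ₐ[k] B₁} {f₂ : B₀ →ₐ[k] B₂} {g₁ : B₁ →ₐ[k] P} {g₂ : B₂ →ₐ[k] P}
    (hcomm : g₁.comp f₁ = g₂.comp f₂)
    (hUP : ∀ (D : Type) [Ring D] [Algebra k D], ∀ (h₁ : B₁ →ₐ[k] D) (h₂ : B₂ →ₐ[k] D),
      h₁.comp f₁ = h₂.comp f₂ → ∃! φ : P →ₐ[k] D, φ.comp g₁ = h₁ ∧ φ.comp g₂ = h₂)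
    (ε : P →ₐ[k] k) (d₁ : B₁ →ₗ[k] N) (d₂ : B₂ →ₗ[k] N)
    (hd₁ : ∀ a b, d₁ (a * b) = g₁ a • d₁ b + ε (g₁ b) • d₁ a)
    (hd₂ : ∀ a b, d₂ (a * b) = g₂ a • d₂ b + ε (g₂ b) • d₂ a)
    (hd : ∀ b, d₁ (f₁ b) = d₂ (f₂ b)) :
    ∃ D : P →ₗ[k] N, (∀ p q, D (p * q) = p • D q + ε q • D p) ∧
      (∀ b, D (g₁ b) = d₁ b) ∧ ∀ b, D (g₂ b) = d₂ b := by
  have hcomm' : ∀ b, g₁ (f₁ b) = g₂ (f₂ b) := DFunLike.congr_fun hcomm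
  obtain ⟨φ, ⟨hφ₁, hφ₂⟩, -⟩ := hUP (Module.End k (N × k))
    (derivationRep g₁ (ε.comp g₁) d₁ hd₁) (derivationRep g₂ (ε.comp g₂) d₂ hd₂) (by
      refine AlgHom.ext fun b => LinearMap.ext fun x => ?_
      change (g₁ (f₁ b) • x.1 + x.2 • d₁ (f₁ b), ε (g₁ (f₁ b)) * x.2) =
        (g₂ (f₂ b) • x.1 + x.2 • d₂ (f₂ b), ε (g₂ (f₂ b)) * x.2)
      rw [hcomm', hd])
  have hφ₁' : ∀ b x, φ (g₁ b) x = (g₁ b • x.1 + x.2 • d₁ b, ε (g₁ b) * x.2) := fun b x =>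
    LinearMap.congr_fun (DFunLike.congr_fun hφ₁ b) x
  have hφ₂' : ∀ b x, φ (g₂ b) x = (g₂ b • x.1 + x.2 • d₂ b, ε (g₂ b) * x.2) := fun b x =>
    LinearMap.congr_fun (DFunLike.congr_fun hφ₂ b) x
  have key : ∀ p, (∀ n : N, φ p (n, 0) = (p • n, 0)) ∧ (φ p (0, 1)).2 = ε p := by
    intro p
    have hp : p ∈ Algebra.adjoin k (Set.range g₁ ∪ Set.range g₂) := by
      rw [adjoin_range_union_range_eq_top_of_pushout hcomm hUP]; trivial
    have split : ∀ x : N × k, x = (x.1, 0) + x.2 • (0, 1) := fun x => by ext <;> simp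
    induction hp using Algebra.adjoin_induction with
    | mem x hx =>
      rcases hx with ⟨b, rfl⟩ | ⟨b, rfl⟩
      · simp [hφ₁']
      · simp [hφ₂']
    | algebraMap r => simp [Algebra.algebraMap_eq_smul_one]
    | add x y _ _ hx hy => simp [hx, hy, add_smul]
    | mul x y _ _ hx hy =>
      refine ⟨fun n => by simp [hx, hy, mul_smul], ?_⟩
      rw [map_mul, Module.End.mul_apply, split (φ y (0, 1)), map_add, map_smul, hy.2, hx.1]
      simp [hx.2, mul_comm]
  refine ⟨(LinearMap.fst k N k).comp ((LinearMap.applyₗ ((0 : N), (1 : k))).comp φ.toLinearMap),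
    fun p q => ?_, fun b => by simp [hφ₁'], fun b => by simp [hφ₂']⟩
  have hq : φ q (0, 1) = ((φ q (0, 1)).1, 0) + ε q • (0, 1) := by
    rw [← (key q).2]; ext <;> simp
  have hpq : φ (p * q) (0, 1) = (p • (φ q (0, 1)).1, 0) + ε q • φ p (0, 1) := by
    rw [map_mul, Module.End.mul_apply, hq, map_add, map_smul, (key p).1]
    simp
  simpa using congrArg Prod.fst hpq

/-- Cokernel statement for an amalgam of augmented `k`-algebras: if `B₀ → B₁`, `B₀ → B₂`
are injective maps of augmented `k`-algebras admitting right `B₀`-module splittings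
`Bᵢ = B₀ ⊕ Bᵢ'`, and `P = B₁ ⊔_{B₀} B₂` is the pushout of `k`-algebras, then the natural
map `P ⊗_{B₀} k → (P ⊗_{B₁} k) ⊕ (P ⊗_{B₂} k)` is injective and its cokernel is
isomorphic to `k` (concentrated in degree `0`).  Here `P ⊗_{Bᵢ} k` is realized as the
quotient of `P` by the submodule generated by `p·gᵢ(b) - εᵢ(b)·p`. -/
theorem amalgam_cosets_map_injective_cokernel_k
    (k : Type) [Field k]
    (B₀ B₁ B₂ P : Type) [Ring B₀] [Ring B₁] [Ring B₂] [Ring P]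
    [Algebra k B₀] [Algebra k B₁] [Algebra k B₂] [Algebra k P]
    (ε₀ : B₀ →ₐ[k] k) (ε₁ : B₁ →ₐ[k] k) (ε₂ : B₂ →ₐ[k] k)
    (f₁ : B₀ →ₐ[k] B₁) (f₂ : B₀ →ₐ[k] B₂)
    (hf₁ : Function.Injective f₁) (hf₂ : Function.Injective f₂)
    (hε₁ : ε₁.comp f₁ = ε₀) (hε₂ : ε₂.comp f₂ = ε₀)
    -- right `B₀`-module splittings `Bᵢ = f_i(B₀) ⊕ Bᵢ'`
    (B₁' : Submodule k B₁) (B₂' : Submodule k B₂)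
    (h₁r : ∀ x ∈ B₁', ∀ a : B₀, x * f₁ a ∈ B₁')
    (h₂r : ∀ x ∈ B₂', ∀ a : B₀, x * f₂ a ∈ B₂')
    (h₁d : Disjoint (LinearMap.range f₁.toLinearMap) B₁')
    (h₁s : LinearMap.range f₁.toLinearMap ⊔ B₁' = ⊤)
    (h₂d : Disjoint (LinearMap.range f₂.toLinearMap) B₂')
    (h₂s : LinearMap.range f₂.toLinearMap ⊔ B₂' = ⊤)
    -- `P` is the pushout of `k`-algebras
    (g₁ : B₁ →ₐ[k] P) (g₂ : B₂ →ₐ[k] P) (hcomm : g₁.comp f₁ = g₂.comp f₂)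
    (hUP : ∀ (D : Type) [Ring D] [Algebra k D], ∀ (h₁ : B₁ →ₐ[k] D) (h₂ : B₂ →ₐ[k] D),
      h₁.comp f₁ = h₂.comp f₂ → ∃! φ : P →ₐ[k] D, φ.comp g₁ = h₁ ∧ φ.comp g₂ = h₂)
    -- the augmentation submodules realizing `P ⊗_{Bᵢ} k`
    (J₀ J₁ J₂ : Submodule k P)
    (hJ₀ : J₀ = Submodule.span k {x | ∃ (p : P) (b : B₀), x = p * g₁ (f₁ b) - ε₀ b • p})
    (hJ₁ : J₁ = Submodule.span k {x | ∃ (p : P) (b : B₁), x = p * g₁ b - ε₁ b • p})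
    (hJ₂ : J₂ = Submodule.span k {x | ∃ (p : P) (b : B₂), x = p * g₂ b - ε₂ b • p})
    -- the natural map induced by the two quotient maps
    (ψ : (P ⧸ J₀) →ₗ[k] (P ⧸ J₁) × (P ⧸ J₂))
    (hψ : ∀ p : P, ψ (Submodule.mkQ J₀ p) = (Submodule.mkQ J₁ p, Submodule.mkQ J₂ p)) :
    Function.Injective ψ ∧
      Nonempty ((((P ⧸ J₁) × (P ⧸ J₂)) ⧸ LinearMap.range ψ) ≃ₗ[k] k) := by
  obtain ⟨ε, ⟨hεg₁, hεg₂⟩, -⟩ := hUP k ε₁ ε₂ (hε₁.trans hε₂.symm)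
  replace hεg₁ : ∀ b, ε (g₁ b) = ε₁ b := DFunLike.congr_fun hεg₁
  replace hεg₂ : ∀ b, ε (g₂ b) = ε₂ b := DFunLike.congr_fun hεg₂
  replace hε₁ : ∀ b, ε₁ (f₁ b) = ε₀ b := DFunLike.congr_fun hε₁
  have mem₁ : ∀ p b, p * g₁ b - ε₁ b • p ∈ J₁ := fun p b =>
    hJ₁ ▸ Submodule.subset_span ⟨p, b, rfl⟩
  have mem₂ : ∀ p b, p * g₂ b - ε₂ b • p ∈ J₂ := fun p b =>
    hJ₂ ▸ Submodule.subset_span ⟨p, b, rfl⟩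
  have inf_le : ∀ x ∈ J₁, x ∈ J₂ → x ∈ J₀ := by
    let J : Submodule P P :=
      { J₀ with
        smul_mem' := fun c x hx => by
          change x ∈ J₀ at hx
          change c • x ∈ J₀
          rw [hJ₀] at hx ⊢
          exact mul_mem_span_augmentation (fun b => g₁ (f₁ b)) ε₀ c hx }
    let π : P →ₗ[P] P ⧸ J := J.mkQ
    let d : B₁ →ₗ[k] P ⧸ J := (π.restrictScalars k).comp
      (g₁.toLinearMap - (Algebra.linearMap k P).comp ε₁.toLinearMap)
    have d_apply : ∀ b, d b = π (g₁ b - ε₁ b • 1) := fun b => by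
      simp [d, Algebra.algebraMap_eq_smul_one]
    obtain ⟨D, hD, hD₁, hD₂⟩ := exists_derivation_of_pushout hcomm hUP ε d 0
      (fun a b => by
        rw [d_apply, d_apply, d_apply, ← map_smul, ← LinearMap.map_smul_of_tower, ← map_add, hεg₁]
        congr 1
        simp only [map_mul, smul_eq_mul, mul_sub, smul_sub, mul_smul_comm, mul_one, smul_smul,
          mul_comm (ε₁ b)]
        abel)
      (by simp)
      (fun b => by
        rw [d_apply, LinearMap.zero_apply, hε₁]
        refine (Submodule.Quotient.mk_eq_zero J).2 ?_
        change _ ∈ J₀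
        rw [hJ₀]
        exact Submodule.subset_span ⟨1, b, by simp⟩)
    have D_one : D 1 = 0 := by simpa using hD 1 1
    have hDJ₁ : ∀ x ∈ J₁, D x = π x := by
      intro x hx
      rw [hJ₁] at hx
      induction hx using Submodule.span_induction with
      | mem x hx =>
        obtain ⟨p, b, rfl⟩ := hx
        rw [map_sub, map_smul, hD, hD₁, hεg₁, add_sub_cancel_right, d_apply, ← map_smul]
        simp [mul_sub]
      | zero => simp
      | add x y _ _ hx hy => rw [map_add, map_add, hx, hy]
      | smul a x _ hx => rw [map_smul, LinearMap.map_smul_of_tower, hx]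
    have hDJ₂ : ∀ x ∈ J₂, D x = 0 := by
      intro x hx
      rw [hJ₂] at hx
      refine (Submodule.span_le (p := LinearMap.ker D)).2 ?_ hx
      rintro _ ⟨p, b, rfl⟩
      simp [hD, hD₂, hεg₂]
    intro x hx₁ hx₂
    exact (Submodule.Quotient.mk_eq_zero J).1 ((hDJ₁ x hx₁).symm.trans (hDJ₂ x hx₂))
  have sup_eq : J₁ ⊔ J₂ = LinearMap.ker ε.toLinearMap := by
    apply le_antisymm
    · rw [hJ₁, hJ₂, sup_le_iff, Submodule.span_le, Submodule.span_le]
      constructor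
      · rintro _ ⟨p, b, rfl⟩
        simp [hεg₁, mul_comm]
      · rintro _ ⟨p, b, rfl⟩
        simp [hεg₂, mul_comm]
    · have key : ∀ p, p - ε p • 1 ∈ J₁ ⊔ J₂ := by
        intro p
        have hp : p ∈ Algebra.adjoin k (Set.range g₁ ∪ Set.range g₂) := by
          rw [adjoin_range_union_range_eq_top_of_pushout hcomm hUP]; trivial
        induction hp using Algebra.adjoin_induction with
        | mem x hx =>
          rcases hx with ⟨b, rfl⟩ | ⟨b, rfl⟩
          · exact Submodule.mem_sup_left (by simpa [hεg₁] using mem₁ 1 b)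
          · exact Submodule.mem_sup_right (by simpa [hεg₂] using mem₂ 1 b)
        | algebraMap r => simp [Algebra.algebraMap_eq_smul_one]
        | add x y _ _ hx hy =>
          simpa only [map_add, add_smul, add_sub_add_comm] using add_mem hx hy
        | mul x y _ _ hx hy =>
          have hxy : x * y - ε (x * y) • 1 = x * (y - ε y • 1) + ε y • (x - ε x • 1) := by
            simp [mul_sub, smul_sub, smul_smul, mul_comm]
          obtain ⟨u, hu, v, hv, huv⟩ := Submodule.mem_sup.1 hy
          rw [hxy, ← huv, mul_add]
          refine add_mem (Submodule.add_mem_sup ?_ ?_) (Submodule.smul_mem _ _ hx)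
          · rw [hJ₁] at hu ⊢; exact mul_mem_span_augmentation g₁ ε₁ x hu
          · rw [hJ₂] at hv ⊢; exact mul_mem_span_augmentation g₂ ε₂ x hv
      intro p hp
      have hp' : ε p = 0 := hp
      simpa [hp'] using key p
  constructor
  · refine (injective_iff_map_eq_zero ψ).2 fun x hx => ?_
    obtain ⟨p, rfl⟩ := J₀.mkQ_surjective x
    rw [hψ, Prod.mk_eq_zero, Submodule.mkQ_apply, Submodule.mkQ_apply,
      Submodule.Quotient.mk_eq_zero, Submodule.Quotient.mk_eq_zero] at hx
    exact (Submodule.Quotient.mk_eq_zero J₀).2 (inf_le p hx.1 hx.2)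
  · let θ : (P ⧸ J₁) × (P ⧸ J₂) →ₗ[k] k :=
      (J₁.liftQ ε.toLinearMap (sup_eq ▸ le_sup_left)).comp (LinearMap.fst k _ _) -
        (J₂.liftQ ε.toLinearMap (sup_eq ▸ le_sup_right)).comp (LinearMap.snd k _ _)
    have hθ : ∀ p q, θ (J₁.mkQ p, J₂.mkQ q) = ε p - ε q := fun p q => by simp [θ]
    have hker : LinearMap.range ψ = LinearMap.ker θ := by
      apply le_antisymm
      · rintro _ ⟨x, rfl⟩
        obtain ⟨p, rfl⟩ := J₀.mkQ_surjective x
        rw [hψ, LinearMap.mem_ker, hθ, sub_self]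
      · rintro ⟨x, y⟩ hxy
        obtain ⟨p, rfl⟩ := J₁.mkQ_surjective x
        obtain ⟨q, rfl⟩ := J₂.mkQ_surjective y
        rw [LinearMap.mem_ker, hθ] at hxy
        have hpq : p - q ∈ J₁ ⊔ J₂ := by
          rw [sup_eq, LinearMap.mem_ker]; simpa using hxy
        obtain ⟨u, hu, v, hv, huv⟩ := Submodule.mem_sup.1 hpq
        refine ⟨J₀.mkQ (p - u), ?_⟩
        rw [hψ]
        refine Prod.ext ((Submodule.Quotient.eq J₁).2 ?_) ((Submodule.Quotient.eq J₂).2 ?_)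
        · simpa using hu
        · rwa [show p - u - q = v by rw [sub_right_comm, ← huv, add_sub_cancel_left]]
    rw [hker]
    refine ⟨θ.quotKerEquivOfSurjective fun c => ⟨(J₁.mkQ (c • 1), J₂.mkQ 0), ?_⟩⟩
    rw [hθ]
    simp
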